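/- Let τ be an equicontinuous Köthe topology on E_K with the Krein-Šmulian property, induced by F. Then for every g ∈ F, the linear functional E_K ∋ f ↦ ∫_Ω fg dμ is τ-continuous. -/

import Mathlib

open MeasureTheory Filter Topology Pointwise

noncomputable section

namespace EquicontKothe

variable {Ω : Type*} [MeasurableSpace Ω] (μ : Measure Ω) [IsProbabilityMeasure μ]

/-- Convergence in probability of a sequence in `L⁰(μ)`. -/
def TendstoInProb (f : ℕ → Ω →ₘ[μ] ℝ) (g : Ω →ₘ[μ] ℝ) : Prop :=
  TendstoInMeasure μ (fun n => ⇑(f n)) atTop ⇑g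

/-- A set of elements of `L⁰(μ)` is closed in probability (stated sequentially, which is
equivalent since the topology of convergence in probability is metrizable). -/
def ClosedInProb (C : Set (Ω →ₘ[μ] ℝ)) : Prop :=
  ∀ f : ℕ → Ω →ₘ[μ] ℝ, (∀ n, f n ∈ C) → ∀ g : Ω →ₘ[μ] ℝ, TendstoInProb μ f g → g ∈ C

/-- Boundedness in probability. -/
def BoundedInProb (C : Set (Ω →ₘ[μ] ℝ)) : Prop :=
  ∀ ε : ℝ, 0 < ε → ∃ δ : ℝ, 0 < δ ∧ ∀ f ∈ C, μ {ω | δ ≤ |f ω|} ≤ ENNReal.ofReal ε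

/-- The polar of a set `C ⊆ L⁰(μ)`. -/
def polar (C : Set (Ω →ₘ[μ] ℝ)) : Set (Ω →ₘ[μ] ℝ) :=
  {g | ∀ f ∈ C, ∫⁻ ω, (‖f ω * g ω‖₊ : ENNReal) ∂μ ≤ 1}

/-- `E_K`, the span of `K`. -/
def EK (K : Set (Ω →ₘ[μ] ℝ)) : Submodule ℝ (Ω →ₘ[μ] ℝ) := Submodule.span ℝ K

/-- `E'_K`, the span of the polar of `K`. -/
def EK' (K : Set (Ω →ₘ[μ] ℝ)) : Submodule ℝ (Ω →ₘ[μ] ℝ) := Submodule.span ℝ (polar μ K)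

/-- The pairing `(f, g) ↦ ∫ fg dμ`. -/
def pair (f g : Ω →ₘ[μ] ℝ) : ℝ := ∫ ω, f ω * g ω ∂μ

/-- A set `F ⊆ L⁰(μ)` is solid. -/
def SolidSet (F : Set (Ω →ₘ[μ] ℝ)) : Prop :=
  ∀ g ∈ F, ∀ h : Ω →ₘ[μ] ℝ, (∀ᵐ ω ∂μ, |h ω| ≤ |g ω|) → h ∈ F

/-- A set `F ⊆ L⁰(μ)` is a linear subspace. -/
def IsSubspace (F : Set (Ω →ₘ[μ] ℝ)) : Prop :=
  (0 : Ω →ₘ[μ] ℝ) ∈ F ∧ (∀ g ∈ F, ∀ h ∈ F, g + h ∈ F) ∧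
    ∀ (a : ℝ) (g : Ω →ₘ[μ] ℝ), g ∈ F → a • g ∈ F

/-- `g` is strictly positive, i.e. `g > 0` a.e. -/
def StrictlyPos (g : Ω →ₘ[μ] ℝ) : Prop := ∀ᵐ ω ∂μ, 0 < g ω

/-- `F` separates the points of the subspace `E` via the pairing `(f,g) ↦ ∫ fg dμ`. -/
def Separates (F : Set (Ω →ₘ[μ] ℝ)) (E : Submodule ℝ (Ω →ₘ[μ] ℝ)) : Prop :=
  ∀ f ∈ E, f ≠ 0 → ∃ g ∈ F, pair μ f g ≠ 0

/-- The weak topology `σ(E, F)` on a subspace `E ⊆ L⁰(μ)` induced by the pairing with `F`. -/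
def weakTop (E : Submodule ℝ (Ω →ₘ[μ] ℝ)) (F : Set (Ω →ₘ[μ] ℝ)) : TopologicalSpace E :=
  ⨅ g ∈ F, TopologicalSpace.induced (fun f : E => pair μ (f : Ω →ₘ[μ] ℝ) g) inferInstance

/-- A set `A ⊆ E_K` is `K`-bounded if it is contained in some positive multiple of `K`. -/
def KBdd (K : Set (Ω →ₘ[μ] ℝ)) (A : Set (EK μ K)) : Prop :=
  ∃ c : ℝ, 0 < c ∧ ∀ f ∈ A, ((f : Ω →ₘ[μ] ℝ)) ∈ c • K

/-- `τ` is an equicontinuous Köthe topology on `E_K` induced by `F`. -/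
def IsEquicontKothe (K : Set (Ω →ₘ[μ] ℝ)) (τ : TopologicalSpace (EK μ K))
    (F : Set (Ω →ₘ[μ] ℝ)) : Prop :=
  @IsCompact _ τ {f : EK μ K | (f : Ω →ₘ[μ] ℝ) ∈ K} ∧
  F ⊆ (EK' μ K : Set (Ω →ₘ[μ] ℝ)) ∧
  IsSubspace μ F ∧
  SolidSet μ F ∧
  (∃ g ∈ F, StrictlyPos μ g) ∧
  Separates μ F (EK μ K) ∧
  ∀ A : Set (EK μ K), KBdd μ K A →
    TopologicalSpace.induced (Subtype.val : A → EK μ K) τ =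
      TopologicalSpace.induced (Subtype.val : A → EK μ K) (weakTop μ (EK μ K) F)

/-- `τ` has the Krein-Šmulian property. -/
def KreinSmulian (K : Set (Ω →ₘ[μ] ℝ)) (τ : TopologicalSpace (EK μ K)) : Prop :=
  ∀ C : Set (EK μ K), Convex ℝ C →
    (@IsClosed _ τ C ↔ ∀ c : ℝ, 0 < c → @IsClosed _ τ (C ∩ {f | (f : Ω →ₘ[μ] ℝ) ∈ c • K}))

/-- Convexity for extended-real-valued functions. -/
def ConvexFn {E : Type*} [AddCommMonoid E] [Module ℝ E] (φ : E → EReal) : Prop :=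
  ∀ f g : E, ∀ a b : ℝ, 0 ≤ a → 0 ≤ b → a + b = 1 →
    φ (a • f + b • g) ≤ (a : EReal) * φ f + (b : EReal) * φ g

/-- Properness: `φ` takes values in `(-∞, ∞]` and is not identically `∞`. -/
def ProperFn {E : Type*} (φ : E → EReal) : Prop :=
  (∀ f, φ f ≠ ⊥) ∧ ∃ f, φ f ≠ ⊤

/-- The equicontinuous Fatou property. -/
def EquicontFatou (K : Set (Ω →ₘ[μ] ℝ)) (φ : EK μ K → EReal) : Prop :=
  ∀ (f : ℕ → EK μ K) (g : EK μ K),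
    (∃ c : ℝ, 0 < c ∧ ∀ n, ((f n : Ω →ₘ[μ] ℝ)) ∈ c • K) →
    TendstoInProb μ (fun n => ((f n : Ω →ₘ[μ] ℝ))) (g : Ω →ₘ[μ] ℝ) →
    φ g ≤ liminf (fun n => φ (f n)) atTop

/-- `τ` is `F`-regular: every `τ`-continuous linear functional is represented by some `g ∈ F`. -/
def FRegular (K : Set (Ω →ₘ[μ] ℝ)) (τ : TopologicalSpace (EK μ K))
    (F : Set (Ω →ₘ[μ] ℝ)) : Prop :=
  ∀ T : EK μ K →ₗ[ℝ] ℝ, @Continuous _ _ τ _ T →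
    ∃ g ∈ F, ∀ f : EK μ K, T f = pair μ (f : Ω →ₘ[μ] ℝ) g

/-- The conjugate `φ*` of `φ` at `g`. -/
def phiStar (K : Set (Ω →ₘ[μ] ℝ)) (φ : EK μ K → EReal) (g : Ω →ₘ[μ] ℝ) : EReal :=
  ⨆ h : EK μ K, ((pair μ (h : Ω →ₘ[μ] ℝ) g : ℝ) : EReal) - φ h

/-- The solid hull of `K`. -/
def solidHull (K : Set (Ω →ₘ[μ] ℝ)) : Set (Ω →ₘ[μ] ℝ) :=
  {f | ∃ g ∈ K, ∀ᵐ ω ∂μ, |f ω| ≤ |g ω|}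

/-- `S` is uniformly `ν`-integrable. -/
def UnifInt (ν : Measure Ω) (S : Set (Ω →ₘ[μ] ℝ)) : Prop :=
  (∀ ε : ℝ, 0 < ε → ∃ δ : ℝ, 0 < δ ∧ ∀ A : Set Ω, MeasurableSet A →
      ν A < ENNReal.ofReal δ →
      ∀ f ∈ S, ∫⁻ ω in A, (‖f ω‖₊ : ENNReal) ∂ν < ENNReal.ofReal ε) ∧
  ∃ C : ℝ, ∀ f ∈ S, ∫⁻ ω, (‖f ω‖₊ : ENNReal) ∂ν ≤ ENNReal.ofReal C

/-- `μ` is non-atomic. -/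
def Nonatomic : Prop :=
  ∀ A : Set Ω, MeasurableSet A → 0 < μ A →
    ∃ B : Set Ω, MeasurableSet B ∧ B ⊆ A ∧ 0 < μ B ∧ μ B < μ A

/-- Increasing with respect to the μ-a.e. order. -/
def MonoInc {E : Submodule ℝ (Ω →ₘ[μ] ℝ)} (φ : E → EReal) : Prop :=
  ∀ f h : E, (∀ᵐ ω ∂μ, (f : Ω →ₘ[μ] ℝ) ω ≤ (h : Ω →ₘ[μ] ℝ) ω) → φ f ≤ φ h

/-- Decreasing with respect to the μ-a.e. order. -/
def MonoDec {E : Submodule ℝ (Ω →ₘ[μ] ℝ)} (φ : E → EReal) : Prop :=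
  ∀ f h : E, (∀ᵐ ω ∂μ, (f : Ω →ₘ[μ] ℝ) ω ≤ (h : Ω →ₘ[μ] ℝ) ω) → φ h ≤ φ f

/-- The `F`-positive Hahn-Banach property of `E_K`. -/
def PosHB (K : Set (Ω →ₘ[μ] ℝ)) (F : Set (Ω →ₘ[μ] ℝ)) : Prop :=
  ∀ T : EK μ K →ₗ[ℝ] ℝ,
    @Continuous _ _ (weakTop μ (EK μ K) F) _ T →
    (∀ f : EK μ K, (∀ᵐ ω ∂μ, 0 ≤ (f : Ω →ₘ[μ] ℝ) ω) → 0 ≤ T f) →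
    ∃ S : EK μ (solidHull μ K) →ₗ[ℝ] ℝ,
      @Continuous _ _ (weakTop μ (EK μ (solidHull μ K)) F) _ S ∧
      (∀ f : EK μ (solidHull μ K), (∀ᵐ ω ∂μ, 0 ≤ (f : Ω →ₘ[μ] ℝ) ω) → 0 ≤ S f) ∧
      ∀ (f : Ω →ₘ[μ] ℝ) (hf : f ∈ EK μ K) (hf' : f ∈ EK μ (solidHull μ K)),
        S ⟨f, hf'⟩ = T ⟨f, hf⟩


omit [IsProbabilityMeasure μ] in
/-- Elements of `E_K` and `E'_K` have integrable products. -/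
theorem integrable_mul_of_mem_EK {K : Set (Ω →ₘ[μ] ℝ)} {f g : Ω →ₘ[μ] ℝ}
    (hf : f ∈ EK μ K) (hg : g ∈ EK' μ K) : Integrable (fun ω => f ω * g ω) μ := by
  induction hf using Submodule.span_induction with
  | mem f hf =>
    induction hg using Submodule.span_induction with
    | mem g hg =>
      exact ⟨f.aestronglyMeasurable.mul g.aestronglyMeasurable,
        (hg f hf).trans_lt ENNReal.one_lt_top⟩
    | zero =>
      refine (integrable_zero Ω ℝ μ).congr ?_
      filter_upwards [AEEqFun.coeFn_zero (α := Ω) (β := ℝ) (μ := μ)] with ω h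
      simp [h]
    | add g₁ g₂ _ _ h₁ h₂ =>
      refine (h₁.add h₂).congr ?_
      filter_upwards [AEEqFun.coeFn_add g₁ g₂] with ω h
      simp [h, mul_add]
    | smul a g _ hg =>
      refine (hg.const_mul a).congr ?_
      filter_upwards [AEEqFun.coeFn_smul a g] with ω h
      simp [h, mul_left_comm]
  | zero =>
    refine (integrable_zero Ω ℝ μ).congr ?_
    filter_upwards [AEEqFun.coeFn_zero (α := Ω) (β := ℝ) (μ := μ)] with ω h
    simp [h]
  | add f₁ f₂ _ _ h₁ h₂ =>
    refine (h₁.add h₂).congr ?_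
    filter_upwards [AEEqFun.coeFn_add f₁ f₂] with ω h
    simp [h, add_mul]
  | smul a f _ hf =>
    refine (hf.const_mul a).congr ?_
    filter_upwards [AEEqFun.coeFn_smul a f] with ω h
    simp [h, mul_assoc]

omit [IsProbabilityMeasure μ] in
/-- On `E_K`, the pairing with an element of `E'_K` is linear. -/
theorem isLinearMap_pair {K : Set (Ω →ₘ[μ] ℝ)} {g : Ω →ₘ[μ] ℝ} (hg : g ∈ EK' μ K) :
    IsLinearMap ℝ (fun f : EK μ K => pair μ (f : Ω →ₘ[μ] ℝ) g) where
  map_add f₁ f₂ := by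
    simp only [pair]
    rw [← integral_add (integrable_mul_of_mem_EK μ f₁.2 hg) (integrable_mul_of_mem_EK μ f₂.2 hg)]
    refine integral_congr_ae ?_
    filter_upwards [AEEqFun.coeFn_add (f₁ : Ω →ₘ[μ] ℝ) f₂] with ω h
    simp [h, add_mul]
  map_smul a f := by
    simp only [pair, smul_eq_mul]
    rw [← integral_const_mul]
    refine integral_congr_ae ?_
    filter_upwards [AEEqFun.coeFn_smul a (f : Ω →ₘ[μ] ℝ)] with ω h
    simp [h, mul_assoc]

omit [IsProbabilityMeasure μ] in
/-- The pairing with an element of `F` is `σ(E, F)`-continuous. -/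
theorem continuous_pair_weakTop (E : Submodule ℝ (Ω →ₘ[μ] ℝ)) {F : Set (Ω →ₘ[μ] ℝ)}
    {g : Ω →ₘ[μ] ℝ} (hg : g ∈ F) :
    @Continuous _ _ (weakTop μ E F) _ (fun f : E => pair μ (f : Ω →ₘ[μ] ℝ) g) :=
  continuous_iff_le_induced.2 (iInf₂_le g hg)

/-- Two topologies inducing the same topology on a set `S` that is closed for the first one:
the trace on `S` of a set closed for the second topology is closed for the first. -/
theorem isClosed_inter_of_induced_eq {X : Type*} {t₁ t₂ : TopologicalSpace X} {S C : Set X}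
    (h : t₁.induced (Subtype.val : S → X) = t₂.induced (Subtype.val : S → X))
    (hS : IsClosed[t₁] S) (hC : IsClosed[t₂] C) : IsClosed[t₁] (C ∩ S) := by
  have hCS : IsClosed[t₂.induced (Subtype.val : S → X)] (Subtype.val ⁻¹' C) :=
    (@isClosed_induced_iff _ _ t₂ _ _).2 ⟨C, hC, rfl⟩
  rw [← h] at hCS
  obtain ⟨D, hD, hDC⟩ := (@isClosed_induced_iff _ _ t₁ _ _).1 hCS
  rw [Subtype.preimage_val_eq_preimage_val_iff] at hDC
  rw [Set.inter_comm, ← hDC]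
  exact @IsClosed.inter _ _ _ t₁ hS hD

omit [IsProbabilityMeasure μ] in
/-- Under the Krein-Šmulian property, convex `σ(E_K, F)`-closed sets are `τ`-closed. -/
theorem KreinSmulian.isClosed_of_convex {K F : Set (Ω →ₘ[μ] ℝ)} {τ : TopologicalSpace (EK μ K)}
    (hKS : KreinSmulian μ K τ) (hτ : IsEquicontKothe μ K τ F) {C : Set (EK μ K)}
    (hconv : Convex ℝ C) (hC : IsClosed[weakTop μ (EK μ K) F] C) : IsClosed[τ] C := by
  refine (hKS C hconv).2 fun c hc => isClosed_inter_of_induced_eq ?_ ?_ hC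
  · exact hτ.2.2.2.2.2.2 _ ⟨c, hc, fun _ hf => hf⟩
  · simpa using (hKS Set.univ convex_univ).1 (@isClosed_univ _ τ) c hc

section Theorems

variable (K : Set (Ω →ₘ[μ] ℝ))

theorem stmt7
    (hconv : Convex ℝ K) (hbal : Balanced ℝ K)
    (hcl : ClosedInProb μ K) (hbdd : BoundedInProb μ K)
    (τ : TopologicalSpace (EK μ K)) (F : Set (Ω →ₘ[μ] ℝ))
    (hτ : IsEquicontKothe μ K τ F) (hKS : KreinSmulian μ K τ)
    (g : Ω →ₘ[μ] ℝ) (hg : g ∈ F) :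
    @Continuous _ _ τ _ (fun f : EK μ K => pair μ (f : Ω →ₘ[μ] ℝ) g) := by
  have hlin := isLinearMap_pair μ (hτ.2.1 hg)
  have hweak := continuous_pair_weakTop μ (EK μ K) hg
  refine @OrderTopology.continuous_iff _ _ _ _ _ τ _ |>.2 fun a => ⟨?_, ?_⟩
  · rw [← @isClosed_compl_iff _ τ, ← Set.preimage_compl, Set.compl_Ioi]
    exact hKS.isClosed_of_convex μ hτ (convex_halfSpace_le hlin a)
      (@IsClosed.preimage _ _ (weakTop μ (EK μ K) F) _ _ hweak _ isClosed_Iic)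
  · rw [← @isClosed_compl_iff _ τ, ← Set.preimage_compl, Set.compl_Iio]
    exact hKS.isClosed_of_convex μ hτ (convex_halfSpace_ge hlin a)
      (@IsClosed.preimage _ _ (weakTop μ (EK μ K) F) _ _ hweak _ isClosed_Ici)

end Theorems

end EquicontKothe
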